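/- arXiv:2511.19698 — 2 statements merged into one kernel-verified Lean document; each statement's English description precedes it below -/
import Mathlib

section
/- For every positive integer n, the number of partitions of n with odd mex equals the number of partitions of n with nonnegative crank (the crank–mex theorem). -/
open scoped Classical

/-- The parts of a partition, sorted in nonincreasing order, so that
`(sortedParts p).getD (i-1) 0` is the `i`-th part `λ_i` (1-indexed). -/
def sortedParts {n : ℕ} (p : n.Partition) : List ℕ :=
  p.parts.sort (· ≥ ·)

/-- The mex of a partition: the smallest positive integer that is not a part. -/
noncomputable def mex {n : ℕ} (p : n.Partition) : ℕ :=
  sInf {m : ℕ | 0 < m ∧ m ∉ p.parts}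

/-- A partition has a fixed point if `λ_i = i` for some index `i`. -/
def hasFixedPoint {n : ℕ} (p : n.Partition) : Prop :=
  ∃ i : ℕ, 0 < i ∧ i ≤ (sortedParts p).length ∧ (sortedParts p).getD (i - 1) 0 = i

/-- `ω(λ)`: the number of parts equal to 1. -/
def omegaStat {n : ℕ} (p : n.Partition) : ℕ := p.parts.count 1

/-- `μ(λ)`: the number of parts greater than `ω(λ)`. -/
def muStat {n : ℕ} (p : n.Partition) : ℕ :=
  (p.parts.filter (fun x => omegaStat p < x)).card

/-- The crank of a partition. -/
def crank {n : ℕ} (p : n.Partition) : ℤ :=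
  if omegaStat p = 0 then (p.parts.sup : ℤ) else (muStat p : ℤ) - (omegaStat p : ℤ)

/-- `β(λ)`: the number of parts greater than 1. -/
def betaStat {n : ℕ} (p : n.Partition) : ℕ :=
  (p.parts.filter (fun x => 1 < x)).card

/-- The Durfee square size: the largest `i` with `λ_i ≥ i` (0 if none). -/
noncomputable def durfee {n : ℕ} (p : n.Partition) : ℕ :=
  sSup {i : ℕ | 0 < i ∧ i ≤ (sortedParts p).length ∧ i ≤ (sortedParts p).getD (i - 1) 0}

/-- number of parts greater than `d` -/
def cgt (s : Multiset ℕ) (d : ℕ) : ℕ := (s.filter (fun x => d < x)).card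

def ParS (n : ℕ) : Set (Multiset ℕ) := {s | (∀ x ∈ s, 0 < x) ∧ s.sum = n}

/-- no `j`-shifted fixed point -/
def FF (j : ℕ) (s : Multiset ℕ) : Prop := ∃ d, cgt s (d + j) = d

/-- the least integer `k > j` that is not a part has `k - j` odd -/
def GG (j : ℕ) (s : Multiset ℕ) : Prop :=
  ∃ t, j + 2 * t + 1 ∉ s ∧ ∀ i, j < i → i ≤ j + 2 * t → i ∈ s

def CC (s : Multiset ℕ) : Prop := s.count 1 ≤ cgt s (s.count 1)

theorem cgt_anti (s : Multiset ℕ) {a b : ℕ} (h : a ≤ b) : cgt s b ≤ cgt s a := by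
  unfold cgt
  apply Multiset.card_le_card
  apply Multiset.monotone_filter_right
  intro x hx
  exact lt_of_le_of_lt h hx

theorem cgt_add (s t : Multiset ℕ) (d : ℕ) : cgt (s + t) d = cgt s d + cgt t d := by
  simp [cgt]

theorem cgt_replicate (k a d : ℕ) : cgt (Multiset.replicate k a) d = if d < a then k else 0 := by
  unfold cgt
  split_ifs with h
  · rw [Multiset.filter_eq_self.2]
    · simp
    · intro x hx; rw [Multiset.eq_of_mem_replicate hx]; exact h
  · rw [Multiset.filter_eq_nil.2]
    · simp
    · intro x hx; rw [Multiset.eq_of_mem_replicate hx]; exact h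

theorem cgt_le_card (s : Multiset ℕ) (d : ℕ) : cgt s d ≤ s.card := by
  unfold cgt
  exact Multiset.card_le_card (Multiset.filter_le _ _)

theorem cgt_succ (s : Multiset ℕ) (d : ℕ) : cgt s d = s.count (d + 1) + cgt s (d + 1) := by
  induction s using Multiset.induction_on with
  | empty => simp [cgt]
  | cons a s ih =>
    unfold cgt at *
    rcases lt_trichotomy a (d + 1) with h | h | h
    · rw [Multiset.filter_cons_of_neg _ (by omega), Multiset.filter_cons_of_neg _ (by omega),
        Multiset.count_cons_of_ne (by omega), ih]
    · rw [Multiset.filter_cons_of_pos _ (by omega), Multiset.filter_cons_of_neg _ (by omega),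
        h, Multiset.count_cons_self, Multiset.card_cons, ih]
      omega
    · rw [Multiset.filter_cons_of_pos _ (by omega), Multiset.filter_cons_of_pos _ (by omega),
        Multiset.count_cons_of_ne (by omega), Multiset.card_cons, Multiset.card_cons, ih]
      omega

theorem cgt_all {s : Multiset ℕ} {d : ℕ} (h : ∀ x ∈ s, d < x) : cgt s d = s.card := by
  unfold cgt
  rw [Multiset.filter_eq_self.2 h]

theorem cgt_none {s : Multiset ℕ} {d : ℕ} (h : ∀ x ∈ s, x ≤ d) : cgt s d = 0 := by
  unfold cgt
  rw [Multiset.filter_eq_nil.2]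
  · simp
  · intro x hx; have := h x hx; omega

theorem ParS_finite (n : ℕ) : (ParS n).Finite := by
  have : ParS n = Set.range (fun p : Nat.Partition n => p.parts) := by
    ext s
    constructor
    · rintro ⟨h1, h2⟩
      exact ⟨⟨s, fun {x} hx => h1 x hx, h2⟩, rfl⟩
    · rintro ⟨p, rfl⟩
      exact ⟨fun x hx => p.parts_pos hx, p.parts_sum⟩
  rw [this]
  exact Set.finite_range _

theorem ncard_parts (n : ℕ) (Q : Multiset ℕ → Prop) :
    {p : Nat.Partition n | Q p.parts}.ncard = {s | s ∈ ParS n ∧ Q s}.ncard := by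
  apply Set.ncard_congr (fun p _ => p.parts)
  · intro p hp
    exact ⟨⟨fun x hx => p.parts_pos hx, p.parts_sum⟩, hp⟩
  · intro p q _ _ h
    exact Nat.Partition.ext h
  · rintro s ⟨⟨h1, h2⟩, h3⟩
    exact ⟨⟨s, fun {x} hx => h1 x hx, h2⟩, h3, rfl⟩

theorem ncard_split (n : ℕ) (Q : Multiset ℕ → Prop) :
    {s | s ∈ ParS n ∧ Q s}.ncard + {s | s ∈ ParS n ∧ ¬ Q s}.ncard = (ParS n).ncard := by
  have hdis : Disjoint {s | s ∈ ParS n ∧ Q s} {s | s ∈ ParS n ∧ ¬ Q s} := by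
    rw [Set.disjoint_left]
    rintro s ⟨_, h⟩ ⟨_, h'⟩
    exact h' h
  rw [← Set.ncard_union_eq hdis ((ParS_finite n).subset (fun s h => h.1))
    ((ParS_finite n).subset (fun s h => h.1))]
  congr 1
  ext s
  simp only [Set.mem_union, Set.mem_ofPred_eq]
  tauto

theorem part_le {n : ℕ} {s : Multiset ℕ} (hs : s ∈ ParS n) {x : ℕ} (hx : x ∈ s) : x ≤ n := by
  rw [← hs.2]
  exact Multiset.le_sum_of_mem hx

/-! ### The mex side -/

theorem GG_erase (j : ℕ) (s : Multiset ℕ) : GG (j + 1) (s.erase (j + 1)) ↔ GG (j + 1) s := by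
  have key : ∀ i, j + 1 < i → (i ∈ s.erase (j + 1) ↔ i ∈ s) := fun i hi =>
    Multiset.mem_erase_of_ne (by omega)
  unfold GG
  constructor
  · rintro ⟨t, h1, h2⟩
    exact ⟨t, by rwa [key _ (by omega)] at h1, fun i hi hi' => (key i hi).1 (h2 i hi hi')⟩
  · rintro ⟨t, h1, h2⟩
    exact ⟨t, by rwa [key _ (by omega)], fun i hi hi' => (key i hi).2 (h2 i hi hi')⟩

theorem exists_first (j : ℕ) (s : Multiset ℕ) :
    ∃ k, j + k + 1 ∉ s ∧ ∀ i, j < i → i ≤ j + k → i ∈ s := by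
  have hex : ∃ k, j + k + 1 ∉ s := by
    refine ⟨s.sum, fun h => ?_⟩
    have := Multiset.le_sum_of_mem h
    omega
  refine ⟨Nat.find hex, Nat.find_spec hex, fun i hi hi' => ?_⟩
  have := Nat.find_min hex (m := i - j - 1) (by omega)
  rw [not_not] at this
  rwa [show j + (i - j - 1) + 1 = i by omega] at this

theorem not_GG (j : ℕ) (s : Multiset ℕ) : ¬ GG j s ↔ j + 1 ∈ s ∧ GG (j + 1) s := by
  constructor
  · intro h
    obtain ⟨k, hk1, hk2⟩ := exists_first j s
    rcases Nat.even_or_odd' k with ⟨t, rfl | rfl⟩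
    · exact absurd ⟨t, hk1, hk2⟩ h
    · refine ⟨hk2 _ (by omega) (by omega), t, ?_, ?_⟩
      · rwa [show j + 1 + 2 * t + 1 = j + (2 * t + 1) + 1 by omega]
      · intro i hi hi'
        exact hk2 i (by omega) (by omega)
  · rintro ⟨h1, t, h2, h3⟩ ⟨u, h4, h5⟩
    rcases le_or_gt u t with h | h
    · rcases Nat.eq_zero_or_pos u with rfl | h0
      · exact h4 h1
      · exact h4 (h3 _ (by omega) (by omega))
    · exact h2 (h5 _ (by omega) (by omega))

theorem GG_step (j m : ℕ) : {s | s ∈ ParS (m + (j + 1)) ∧ ¬ GG j s}.ncard =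
    {s | s ∈ ParS m ∧ GG (j + 1) s}.ncard := by
  apply Set.ncard_congr (fun s _ => s.erase (j + 1))
  · rintro s ⟨⟨h1, h2⟩, h3⟩
    obtain ⟨h4, h5⟩ := (not_GG j s).1 h3
    refine ⟨⟨fun x hx => h1 x (Multiset.mem_of_mem_erase hx), ?_⟩, (GG_erase j s).2 h5⟩
    have := Multiset.sum_erase h4
    omega
  · rintro s t ⟨_, hs⟩ ⟨_, ht⟩ h
    have h1 := ((not_GG j s).1 hs).1
    have h2 := ((not_GG j t).1 ht).1
    rw [← Multiset.cons_erase h1, h, Multiset.cons_erase h2]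
  · rintro s ⟨⟨h1, h2⟩, h3⟩
    refine ⟨(j + 1) ::ₘ s, ⟨⟨?_, ?_⟩, ?_⟩, by simp⟩
    · intro x hx
      rcases Multiset.mem_cons.1 hx with rfl | hx
      · omega
      · exact h1 x hx
    · rw [Multiset.sum_cons]; omega
    · rw [not_GG]
      refine ⟨by simp, ?_⟩
      rw [← GG_erase]
      simpa using h3

/-! ### The fixed point side -/

/-- the data `(d, s)` ↦ the partition with a shifted fixed point, `b = d + j + 1` -/
def ins (b : ℕ) (s : Multiset ℕ) : Multiset ℕ :=
  (s.filter (fun x => b < x)).map (fun x => x - 1) + {b} + s.filter (fun x => ¬ b < x)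

theorem top_eq (X : Multiset ℕ) (b : ℕ) (h : ∀ x ∈ X, b ≤ x) :
    X = X.filter (fun x => b < x) + Multiset.replicate (X.card - cgt X b) b := by
  have h1 := Multiset.filter_add_not (fun x => b < x) X
  have h2 : X.filter (fun x => ¬ b < x) =
      Multiset.replicate (X.filter (fun x => ¬ b < x)).card b := by
    rw [Multiset.eq_replicate_card]
    intro x hx
    rw [Multiset.mem_filter] at hx
    have := h x hx.1
    omega
  have h3 : X.card = cgt X b + (X.filter (fun x => ¬ b < x)).card := by
    conv_lhs => rw [← h1]
    rw [Multiset.card_add]; rfl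
  rw [h3, Nat.add_sub_cancel_left, ← h2, h1]

theorem topPart_unique {X Y B C : Multiset ℕ} {b : ℕ} (hX : ∀ x ∈ X, b ≤ x) (hY : ∀ x ∈ Y, b ≤ x)
    (hB : ∀ x ∈ B, x ≤ b) (hC : ∀ x ∈ C, x ≤ b) (hc : X.card = Y.card) (h : X + B = Y + C) :
    X = Y := by
  have hf : X.filter (fun x => b < x) = Y.filter (fun x => b < x) := by
    have := congrArg (Multiset.filter (fun x => b < x)) h
    rw [Multiset.filter_add, Multiset.filter_add, (Multiset.filter_eq_nil (s := B)).2,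
      (Multiset.filter_eq_nil (s := C)).2] at this
    · simpa using this
    · intro x hx; have := hC x hx; omega
    · intro x hx; have := hB x hx; omega
  rw [top_eq X b hX, top_eq Y b hY, hc]
  unfold cgt
  rw [hf]

theorem map_pred_succ (X : Multiset ℕ) (h : ∀ x ∈ X, 0 < x) :
    (X.map (fun x => x - 1)).map (fun x => x + 1) = X := by
  rw [Multiset.map_map]
  conv_rhs => rw [← Multiset.map_id X]
  apply Multiset.map_congr rfl
  intro x hx
  have := h x hx
  simp; omega

theorem sum_map_pred (X : Multiset ℕ) (h : ∀ x ∈ X, 0 < x) :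
    (X.map (fun x => x - 1)).sum + X.card = X.sum := by
  induction X using Multiset.induction_on with
  | empty => simp
  | cons a s ih =>
    have h1 := ih (fun x hx => h x (Multiset.mem_cons_of_mem hx))
    have h2 := h a (by simp)
    simp only [Multiset.map_cons, Multiset.sum_cons, Multiset.card_cons]
    omega

theorem ins_mid {b : ℕ} {s : Multiset ℕ} {d : ℕ} (hb : 0 < b) (hd : cgt s b = d) :
    d + 1 ≤ cgt (ins b s) (b - 1) ∧ cgt (ins b s) b ≤ d := by
  have hX : ∀ x ∈ (s.filter (fun x => b < x)).map (fun x => x - 1), b - 1 < x := by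
    intro x hx
    obtain ⟨y, hy, rfl⟩ := Multiset.mem_map.1 hx
    have := (Multiset.mem_filter.1 hy).2
    omega
  have hc : ((s.filter (fun x => b < x)).map (fun x => x - 1)).card = d := by
    rw [Multiset.card_map]; exact hd
  unfold ins
  rw [cgt_add, cgt_add, cgt_add, cgt_add, cgt_all hX, hc]
  have h1 : cgt ({b} : Multiset ℕ) (b - 1) = 1 := by
    rw [cgt_all] <;> simp; omega
  have h2 : cgt ({b} : Multiset ℕ) b = 0 := by
    rw [cgt_none]; simp
  have h3 : cgt (s.filter (fun x => ¬ b < x)) b = 0 := by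
    rw [cgt_none]
    intro x hx
    have := (Multiset.mem_filter.1 hx).2
    omega
  have h4 := cgt_le_card ((s.filter (fun x => b < x)).map (fun x => x - 1)) b
  omega

theorem ins_inj {b : ℕ} {s t : Multiset ℕ} (hst : cgt s b = cgt t b)
    (h : ins b s = ins b t) : s = t := by
  have hX : ∀ s : Multiset ℕ, ∀ x ∈ (s.filter (fun x => b < x)).map (fun x => x - 1), b ≤ x := by
    intro s x hx
    obtain ⟨y, hy, rfl⟩ := Multiset.mem_map.1 hx
    have := (Multiset.mem_filter.1 hy).2
    omega
  have hB : ∀ s : Multiset ℕ, ∀ x ∈ {b} + s.filter (fun x => ¬ b < x), x ≤ b := by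
    intro s x hx
    rcases Multiset.mem_add.1 hx with hx | hx
    · simp at hx; omega
    · have := (Multiset.mem_filter.1 hx).2
      omega
  have h' := h
  unfold ins at h
  rw [add_assoc, add_assoc] at h
  have h1 := topPart_unique (hX s) (hX t) (hB s) (hB t)
    (by rw [Multiset.card_map, Multiset.card_map]; exact hst) h
  rw [h1] at h
  have h2 := add_left_cancel (add_left_cancel h)
  have h3 := congrArg (Multiset.map (fun x => x + 1)) h1
  rw [map_pred_succ, map_pred_succ] at h3
  · rw [← Multiset.filter_add_not (fun x => b < x) s, h2, h3, Multiset.filter_add_not]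
  · intro x hx
    have := (Multiset.mem_filter.1 hx).2
    omega
  · intro x hx
    have := (Multiset.mem_filter.1 hx).2
    omega

theorem ins_surj {b : ℕ} {u : Multiset ℕ} {d : ℕ} (hb : 0 < b) (hu : ∀ x ∈ u, 0 < x)
    (h1 : d + 1 ≤ cgt u (b - 1)) (h2 : cgt u b ≤ d) :
    ∃ s, (∀ x ∈ s, 0 < x) ∧ cgt s b = d ∧ ins b s = u := by
  have h3 : cgt u (b - 1) = u.count b + cgt u b := by
    have := cgt_succ u (b - 1)
    rwa [Nat.sub_add_cancel hb] at this
  set X := u.filter (fun x => b < x) + Multiset.replicate (d - cgt u b) b with hXdef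
  set B := u.filter (fun x => x < b) + Multiset.replicate (u.count b - (d - cgt u b) - 1) b
    with hBdef
  have hX : ∀ x ∈ X, b ≤ x := by
    intro x hx
    rcases Multiset.mem_add.1 hx with hx | hx
    · exact (Multiset.mem_filter.1 hx).2.le
    · exact (Multiset.eq_of_mem_replicate hx).ge
  have hB : ∀ x ∈ B, x ≤ b := by
    intro x hx
    rcases Multiset.mem_add.1 hx with hx | hx
    · exact (Multiset.mem_filter.1 hx).2.le
    · exact (Multiset.eq_of_mem_replicate hx).le
  have hB0 : ∀ x ∈ B, 0 < x := by
    intro x hx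
    rcases Multiset.mem_add.1 hx with hx | hx
    · exact hu x (Multiset.mem_filter.1 hx).1
    · rw [Multiset.eq_of_mem_replicate hx]; exact hb
  have hXc : X.card = d := by
    rw [hXdef, Multiset.card_add, Multiset.card_replicate]
    change cgt u b + _ = _
    omega
  have hXs : ∀ x ∈ X.map (fun x => x + 1), b < x := by
    intro x hx
    obtain ⟨y, hy, rfl⟩ := Multiset.mem_map.1 hx
    have := hX y hy
    omega
  have hf1 : (X.map (fun x => x + 1) + B).filter (fun x => b < x) = X.map (fun x => x + 1) := by
    rw [Multiset.filter_add, Multiset.filter_eq_self.2 hXs, Multiset.filter_eq_nil.2, add_zero]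
    intro x hx
    have := hB x hx
    omega
  have hf2 : (X.map (fun x => x + 1) + B).filter (fun x => ¬ b < x) = B := by
    rw [Multiset.filter_add, Multiset.filter_eq_nil.2, Multiset.filter_eq_self.2, zero_add]
    · intro x hx
      have := hB x hx
      omega
    · intro x hx
      have := hXs x hx
      omega
  refine ⟨X.map (fun x => x + 1) + B, ?_, ?_, ?_⟩
  · intro x hx
    rcases Multiset.mem_add.1 hx with hx | hx
    · have := hXs x hx; omega
    · exact hB0 x hx
  · unfold cgt
    rw [hf1, Multiset.card_map, hXc]
  · unfold ins
    rw [hf1, hf2, Multiset.map_map]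
    have : X.map ((fun x => x - 1) ∘ (fun x => x + 1)) = X := by
      conv_rhs => rw [← Multiset.map_id X]
      apply Multiset.map_congr rfl
      intro x _
      simp
    rw [this, hXdef, hBdef]
    ext x
    simp only [Multiset.count_add, Multiset.count_filter, Multiset.count_replicate,
      Multiset.count_singleton]
    rcases lt_trichotomy x b with h | h | h
    · simp [h, h.ne, h.ne', h.not_gt]
    · subst h
      simp
      omega
    · simp [h, h.ne, h.ne', h.not_gt]

theorem ins_sum {b : ℕ} {s : Multiset ℕ} : (ins b s).sum + cgt s b = s.sum + b := by
  have h1 := sum_map_pred (s.filter (fun x => b < x)) (fun x hx => by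
    have := (Multiset.mem_filter.1 hx).2
    omega)
  have h2 := congrArg Multiset.sum (Multiset.filter_add_not (fun x => b < x) s)
  rw [Multiset.sum_add] at h2
  unfold ins
  rw [Multiset.sum_add, Multiset.sum_add, Multiset.sum_singleton]
  unfold cgt
  omega

theorem ins_pos {b : ℕ} {s : Multiset ℕ} (hb : 0 < b) (hs : ∀ x ∈ s, 0 < x) :
    ∀ x ∈ ins b s, 0 < x := by
  intro x hx
  unfold ins at hx
  rcases Multiset.mem_add.1 hx with hx | hx
  · rcases Multiset.mem_add.1 hx with hx | hx
    · obtain ⟨y, hy, rfl⟩ := Multiset.mem_map.1 hx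
      have := (Multiset.mem_filter.1 hy).2
      omega
    · simp at hx; omega
  · exact hs x (Multiset.mem_filter.1 hx).1

theorem not_FF (j : ℕ) (s : Multiset ℕ) :
    ¬ FF j s ↔ ∃ d, d + 1 ≤ cgt s (d + j) ∧ cgt s (d + 1 + j) ≤ d := by
  constructor
  · intro h
    have hex : ∃ i, cgt s (i + j) ≤ i := ⟨s.card, cgt_le_card _ _⟩
    have h1 := Nat.find_spec hex
    have h2 : cgt s (Nat.find hex + j) ≠ Nat.find hex := fun h' => h ⟨_, h'⟩
    obtain ⟨d, hd⟩ : ∃ d, Nat.find hex = d + 1 := ⟨Nat.find hex - 1, by omega⟩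
    have h3 := Nat.find_min hex (m := d) (by omega)
    rw [hd] at h1 h2
    exact ⟨d, by omega, by omega⟩
  · rintro ⟨d, h1, h2⟩ ⟨e, he⟩
    rcases le_or_gt e d with h | h
    · have := cgt_anti s (show e + j ≤ d + j by omega)
      omega
    · have := cgt_anti s (show d + 1 + j ≤ e + j by omega)
      omega

theorem FF_step (j m : ℕ) : {s | s ∈ ParS (m + (j + 1)) ∧ ¬ FF j s}.ncard =
    {s | s ∈ ParS m ∧ FF (j + 1) s}.ncard := by
  symm
  apply Set.ncard_congr (fun s (hs : s ∈ ParS m ∧ FF (j + 1) s) =>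
    ins (Classical.choose hs.2 + (j + 1)) s)
  · rintro s hs
    have hd := Classical.choose_spec hs.2
    set d := Classical.choose hs.2
    have h := ins_mid (by omega) hd
    refine ⟨⟨ins_pos (by omega) hs.1.1, ?_⟩, (not_FF j _).2 ⟨d, ?_, ?_⟩⟩
    · have := ins_sum (b := d + (j + 1)) (s := s)
      rw [hs.1.2] at this
      omega
    · exact h.1
    · rw [show d + 1 + j = d + (j + 1) by omega]; exact h.2
  · intro s t hs ht h
    have hd := Classical.choose_spec hs.2
    have he := Classical.choose_spec ht.2
    set d := Classical.choose hs.2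
    set e := Classical.choose ht.2
    have h1 := ins_mid (by omega) hd
    have h2 := ins_mid (by omega) he
    rw [← h] at h2
    set u := ins (d + (j + 1)) s
    have hde : d = e := by
      rcases lt_trichotomy d e with h' | h' | h'
      · have := cgt_anti u (show d + (j + 1) ≤ e + (j + 1) - 1 by omega)
        omega
      · exact h'
      · have := cgt_anti u (show e + (j + 1) ≤ d + (j + 1) - 1 by omega)
        omega
    rw [← hde] at h he
    exact ins_inj (hd.trans he.symm) h
  · rintro u ⟨⟨hu1, hu2⟩, hu3⟩
    obtain ⟨d, h1, h2⟩ := (not_FF j u).1 hu3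
    rw [show d + 1 + j = d + (j + 1) by omega] at h2
    obtain ⟨s, hs1, hs2, hs3⟩ := ins_surj (b := d + (j + 1)) (by omega) hu1 h1 h2
    have hF : FF (j + 1) s := ⟨d, hs2⟩
    have hsum : s.sum = m := by
      have := ins_sum (b := d + (j + 1)) (s := s)
      rw [hs3] at this
      omega
    refine ⟨s, ⟨⟨hs1, hsum⟩, hF⟩, ?_⟩
    have he := Classical.choose_spec hF
    change ins (Classical.choose hF + (j + 1)) s = u
    set e := Classical.choose hF
    have hde : d = e := by
      rcases lt_trichotomy d e with h' | h' | h'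
      · have := cgt_anti s (show d + (j + 1) ≤ e + (j + 1) by omega)
        omega
      · exact h'
      · have := cgt_anti s (show e + (j + 1) ≤ d + (j + 1) by omega)
        omega
    rw [← hde, hs3]

theorem FF_eq_GG (m : ℕ) : ∀ j, {s | s ∈ ParS m ∧ FF j s}.ncard =
    {s | s ∈ ParS m ∧ GG j s}.ncard := by
  induction m using Nat.strong_induction_on with
  | _ m ih =>
    intro j
    have h1 := ncard_split m (FF j)
    have h2 := ncard_split m (GG j)
    rcases le_or_gt (j + 1) m with h | h
    · obtain ⟨k, rfl⟩ : ∃ k, m = k + (j + 1) := ⟨m - (j + 1), by omega⟩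
      rw [FF_step] at h1
      rw [GG_step] at h2
      have := ih k (by omega) (j + 1)
      omega
    · congr 1
      ext s
      simp only [Set.mem_ofPred_eq]
      apply and_congr_right
      intro hs
      have hF : FF j s := ⟨0, cgt_none (fun x hx => by have := part_le hs hx; omega)⟩
      have hG : GG j s := by
        refine ⟨0, fun hx => ?_, fun i _ _ => by omega⟩
        have := part_le hs hx
        omega
      exact ⟨fun _ => hG, fun _ => hF⟩

/-! ### The crank side -/

def cmap (d : ℕ) (s : Multiset ℕ) : Multiset ℕ :=
  s.filter (fun x => x ≠ 1) + Multiset.replicate (s.count 1 % (d + 1)) 1 +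
    Multiset.replicate (s.count 1 / (d + 1)) (d + 1)

theorem split_one (s : Multiset ℕ) :
    s = s.filter (fun x => x ≠ 1) + Multiset.replicate (s.count 1) 1 := by
  ext x
  rw [Multiset.count_add, Multiset.count_filter, Multiset.count_replicate]
  by_cases h : x = 1
  · subst h; simp
  · simp [h, Ne.symm h]

theorem cmap_sum (d : ℕ) (s : Multiset ℕ) : (cmap d s).sum = s.sum := by
  conv_rhs => rw [split_one s]
  unfold cmap
  simp only [Multiset.sum_add, Multiset.sum_replicate, smul_eq_mul, mul_one]
  have := Nat.mod_add_div' (s.count 1) (d + 1)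
  omega

theorem cmap_cgt {d : ℕ} (hd : 0 < d) (s : Multiset ℕ) :
    cgt (cmap d s) d = cgt s d + s.count 1 / (d + 1) ∧ cgt (cmap d s) (d + 1) = cgt s (d + 1) := by
  have h := split_one s
  have key : ∀ e, cgt s e = cgt (s.filter (fun x => x ≠ 1)) e +
      cgt (Multiset.replicate (s.count 1) 1) e := by
    intro e
    rw [← cgt_add, ← h]
  rw [key d, key (d + 1)]
  unfold cmap
  simp only [cgt_add, cgt_replicate]
  rw [if_neg (by omega), if_pos (by omega), if_neg (by omega), if_neg (by omega)]
  simp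

theorem cmap_count_one {d : ℕ} (hd : 0 < d) (s : Multiset ℕ) :
    (cmap d s).count 1 = s.count 1 % (d + 1) := by
  unfold cmap
  simp [Multiset.count_replicate]
  omega

theorem FF_unique {s : Multiset ℕ} {d e : ℕ} (hd : cgt s d = d) (he : cgt s e = e) : d = e := by
  rcases lt_trichotomy d e with h' | h' | h'
  · have := cgt_anti s h'.le
    omega
  · exact h'
  · have := cgt_anti s h'.le
    omega

theorem eq_zero_of {s : Multiset ℕ} (hs : ∀ x ∈ s, 0 < x) (h : cgt s 0 = 0) : s = 0 := by
  rw [cgt_all hs] at h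
  exact Multiset.card_eq_zero.1 h

theorem FF_CC (n : ℕ) (hn : 0 < n) : {s | s ∈ ParS n ∧ FF 0 s}.ncard =
    {s | s ∈ ParS n ∧ CC s}.ncard := by
  have hpos : ∀ s ∈ ParS n, ∀ d, cgt s d = d → 0 < d := by
    intro s hs d h
    rcases Nat.eq_zero_or_pos d with rfl | h'
    · have h0 := eq_zero_of hs.1 h
      have := hs.2
      rw [h0] at this
      simp at this
      omega
    · exact h'
  apply Set.ncard_congr (fun s (hs : s ∈ ParS n ∧ FF 0 s) => cmap (Classical.choose hs.2) s)
  · intro s hs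
    have hd : cgt s (Classical.choose hs.2) = _ := Classical.choose_spec hs.2
    set d := Classical.choose hs.2
    have hd0 := hpos s hs.1 d hd
    obtain ⟨h1, h2⟩ := cmap_cgt hd0 s
    refine ⟨⟨?_, ?_⟩, ?_⟩
    · intro x hx
      unfold cmap at hx
      rcases Multiset.mem_add.1 hx with hx | hx
      · rcases Multiset.mem_add.1 hx with hx | hx
        · exact hs.1.1 x (Multiset.mem_filter.1 hx).1
        · rw [Multiset.eq_of_mem_replicate hx]; omega
      · rw [Multiset.eq_of_mem_replicate hx]; omega
    · rw [cmap_sum]; exact hs.1.2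
    · unfold CC
      rw [cmap_count_one hd0]
      have hq0 := Nat.zero_le (s.count 1 / (d + 1))
      have hlt := Nat.mod_lt (s.count 1) (show 0 < d + 1 by omega)
      have := cgt_anti (cmap d s) (show s.count 1 % (d + 1) ≤ d by omega)
      omega
  · intro s t hs ht h
    have hd : cgt s (Classical.choose hs.2) = _ := Classical.choose_spec hs.2
    have he : cgt t (Classical.choose ht.2) = _ := Classical.choose_spec ht.2
    set d := Classical.choose hs.2
    set e := Classical.choose ht.2
    have hd0 := hpos s hs.1 d hd
    have he0 := hpos t ht.1 e he
    have h1 := cmap_cgt hd0 s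
    have h2 := cmap_cgt he0 t
    have h3 := cmap_count_one hd0 s
    have h4 := cmap_count_one he0 t
    have hd' := cgt_anti s (show d ≤ d + 1 by omega)
    have he' := cgt_anti t (show e ≤ e + 1 by omega)
    have hq0 := Nat.zero_le (s.count 1 / (d + 1))
    have hq1 := Nat.zero_le (t.count 1 / (e + 1))
    have hde : d = e := by
      rw [← h] at h2
      rcases lt_trichotomy d e with h' | h' | h'
      · have := cgt_anti (cmap d s) (show d + 1 ≤ e by omega)
        omega
      · exact h'
      · have := cgt_anti (cmap d s) (show e + 1 ≤ d by omega)
        omega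
    rw [← hde] at h h2 h4 he
    rw [← h] at h2 h4
    have hq : s.count 1 / (d + 1) = t.count 1 / (d + 1) := by omega
    have hr : s.count 1 % (d + 1) = t.count 1 % (d + 1) := by omega
    have hc : s.count 1 = t.count 1 := by
      rw [← Nat.mod_add_div (s.count 1) (d + 1), hq, hr, Nat.mod_add_div]
    unfold cmap at h
    rw [hq, hr] at h
    have hfil := add_right_cancel (add_right_cancel h)
    rw [split_one s, split_one t, hfil, hc]
  · rintro u ⟨⟨hu1, hu2⟩, hu3⟩
    have hex : ∃ d, cgt u (d + 1) < d + 1 :=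
      ⟨u.card, Nat.lt_succ_of_le (cgt_le_card _ _)⟩
    obtain ⟨d, hd1, hd2⟩ : ∃ d, cgt u (d + 1) < d + 1 ∧ d ≤ cgt u d := by
      refine ⟨Nat.find hex, Nat.find_spec hex, ?_⟩
      rcases Nat.eq_zero_or_pos (Nat.find hex) with h | h
      · omega
      · have := Nat.find_min hex (m := Nat.find hex - 1) (by omega)
        rw [Nat.sub_add_cancel h] at this
        omega
    have hw : u.count 1 ≤ d := by
      by_contra hcon
      have := cgt_anti u (show d + 1 ≤ u.count 1 by omega)
      unfold CC at hu3
      omega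
    have hsucc := cgt_succ u d
    have hd0 : 0 < d := by
      rcases Nat.eq_zero_or_pos d with rfl | h'
      · have h0 := eq_zero_of hu1 (by simp only [zero_add] at *; omega)
        rw [h0] at hu2
        simp at hu2
        omega
      · exact h'
    obtain ⟨k, hk⟩ : ∃ k, cgt u d = d + k := ⟨cgt u d - d, by omega⟩
    have hle : Multiset.replicate k (d + 1) ≤ u := by
      rw [← Multiset.le_count_iff_replicate_le]
      omega
    obtain ⟨v, rfl⟩ := Multiset.le_iff_exists_add.1 hle
    have hv1 : v.count 1 ≤ d := by
      rw [Multiset.count_add] at hw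
      omega
    set s := v + Multiset.replicate (k * (d + 1)) 1 with hs
    have hsd : cgt s d = d := by
      rw [cgt_add, cgt_replicate, if_pos (by omega)] at hk
      rw [hs, cgt_add, cgt_replicate, if_neg (by omega)]
      omega
    have hF : FF 0 s := ⟨d, hsd⟩
    have hcs : s.count 1 = v.count 1 + k * (d + 1) := by
      rw [hs, Multiset.count_add, Multiset.count_replicate_self]
    have hmod : s.count 1 % (d + 1) = v.count 1 := by
      rw [hcs, Nat.add_mul_mod_self_right, Nat.mod_eq_of_lt (by omega)]
    have hdiv : s.count 1 / (d + 1) = k := by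
      rw [hcs, Nat.add_mul_div_right _ _ (by omega), Nat.div_eq_of_lt (by omega), zero_add]
    have hfil : s.filter (fun x => x ≠ 1) = v.filter (fun x => x ≠ 1) := by
      rw [hs, Multiset.filter_add, (Multiset.filter_eq_nil (s := Multiset.replicate _ _)).2,
        add_zero]
      intro x hx
      simp [Multiset.eq_of_mem_replicate hx]
    have hcm : cmap d s = Multiset.replicate k (d + 1) + v := by
      unfold cmap
      rw [hmod, hdiv, hfil, ← split_one, add_comm]
    refine ⟨s, ⟨⟨?_, ?_⟩, hF⟩, ?_⟩
    · intro x hx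
      rcases Multiset.mem_add.1 hx with hx | hx
      · exact hu1 x (Multiset.mem_add.2 (Or.inr hx))
      · rw [Multiset.eq_of_mem_replicate hx]; omega
    · rw [← cmap_sum d s, hcm]; exact hu2
    · have he : cgt s (Classical.choose hF) = _ := Classical.choose_spec hF
      change cmap (Classical.choose hF) s = _
      rw [← FF_unique hsd he, hcm]

theorem odd_mex_iff {n : ℕ} (p : n.Partition) : Odd (mex p) ↔ GG 0 p.parts := by
  have hmex : ∀ k, k + 1 ∉ p.parts → (∀ i, 0 < i → i ≤ k → i ∈ p.parts) → mex p = k + 1 := by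
    intro k h1 h2
    unfold mex
    apply le_antisymm
    · exact Nat.sInf_le ⟨by omega, h1⟩
    · have hne : {m : ℕ | 0 < m ∧ m ∉ p.parts}.Nonempty := ⟨k + 1, by omega, h1⟩
      apply le_csInf hne
      rintro b ⟨hb1, hb2⟩
      by_contra hcon
      exact hb2 (h2 b hb1 (by omega))
  constructor
  · intro h
    obtain ⟨k, h1, h2⟩ := exists_first 0 p.parts
    rw [zero_add] at h1 h2
    rw [hmex k h1 h2] at h
    obtain ⟨t, ht⟩ := h
    obtain rfl : k = 2 * t := by omega
    exact ⟨t, by simpa using h1, by simpa using h2⟩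
  · rintro ⟨t, h1, h2⟩
    rw [zero_add] at h1 h2
    rw [hmex _ h1 h2]
    exact ⟨t, rfl⟩

theorem crank_iff {n : ℕ} (p : n.Partition) : 0 ≤ crank p ↔ CC p.parts := by
  unfold crank CC
  change _ ↔ omegaStat p ≤ muStat p
  split_ifs with h
  · rw [h]; simp
  · omega

theorem crank_mex (n : ℕ) (hn : 0 < n) :
    {p : Nat.Partition n | Odd (mex p)}.ncard = {p : Nat.Partition n | 0 ≤ crank p}.ncard := by
  simp only [odd_mex_iff, crank_iff]
  rw [ncard_parts n (GG 0), ncard_parts n CC, ← FF_CC n hn, FF_eq_GG]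
end

section
/- For every positive integer n and every nonnegative integer k, the number of partitions of n with odd mex and exactly k parts greater than 1 equals the number of partitions of n with nonnegative crank and exactly k parts greater than 1. -/
open scoped Classical

namespace CrankMex

/-- number of parts at least `x` -/
def c (π : Multiset ℕ) (x : ℕ) : ℕ := π.countP (fun y => x ≤ y)

lemma c_anti (π : Multiset ℕ) {x y : ℕ} (h : x ≤ y) : c π y ≤ c π x := by
  unfold c
  rw [Multiset.countP_eq_card_filter, Multiset.countP_eq_card_filter]
  exact Multiset.card_le_card (Multiset.monotone_filter_right π (fun a ha => h.trans ha))

lemma c_cons (π : Multiset ℕ) (a x : ℕ) : c (a ::ₘ π) x = c π x + if x ≤ a then 1 else 0 := by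
  unfold c
  rw [Multiset.countP_cons]

lemma c_le_card (π : Multiset ℕ) (x : ℕ) : c π x ≤ π.card := Multiset.countP_le_card _ _

lemma c_count (π : Multiset ℕ) (x : ℕ) : c π x = c π (x+1) + π.count x := by
  induction π using Multiset.induction_on with
  | empty => simp [c]
  | cons a s ih =>
    rw [c_cons, c_cons, Multiset.count_cons, ih]
    split_ifs <;> omega

lemma ext_c {π ρ : Multiset ℕ} (h : ∀ x, c π x = c ρ x) : π = ρ := by
  ext x
  have h1 := c_count π x
  have h2 := c_count ρ x
  rw [h, h] at h1
  omega

lemma dur_ex (s : ℕ) (π : Multiset ℕ) : ∃ d, c π (d+s+1) ≤ d := ⟨π.card, c_le_card _ _⟩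

/-- Durfee-type statistic -/
noncomputable def dur (s : ℕ) (π : Multiset ℕ) : ℕ := Nat.find (dur_ex s π)

lemma dur_spec (s : ℕ) (π : Multiset ℕ) : c π (dur s π + s + 1) ≤ dur s π :=
  Nat.find_spec (dur_ex s π)

lemma dur_le (s : ℕ) (π : Multiset ℕ) : dur s π ≤ c π (dur s π + s) := by
  rcases h : dur s π with _ | d
  · simp
  · have : ¬ c π (d+s+1) ≤ d := Nat.find_min (dur_ex s π) (by change d < dur s π; omega)
    have e : d + 1 + s = d + s + 1 := by ring
    rw [e]; omega

lemma lt_dur (s : ℕ) (π : Multiset ℕ) (w : ℕ) : w < c π (w+s+1) ↔ w < dur s π := by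
  constructor
  · intro h
    by_contra hc
    have := c_anti π (show dur s π + s + 1 ≤ w+s+1 by omega)
    have := dur_spec s π
    omega
  · intro h
    have := c_anti π (show w+s+1 ≤ dur s π + s by omega)
    have := dur_le s π
    omega

lemma dur_eq {s : ℕ} {π : Multiset ℕ} {d : ℕ} (h1 : d ≤ c π (d+s)) (h2 : c π (d+s+1) ≤ d) :
    dur s π = d := by
  apply le_antisymm
  · exact Nat.find_min' _ h2
  · by_contra hc
    have := c_anti π (show dur s π + s + 1 ≤ d + s by omega)
    have := dur_spec s π
    omega

/-- multisets of `k` parts at least two with sum at most `N` -/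
noncomputable def S (N k : ℕ) : Finset (Multiset ℕ) :=
  ((Finset.range (N+1)).biUnion (fun m =>
    (Finset.univ : Finset (Nat.Partition m)).image (fun p => p.parts))).filter
      (fun π => (∀ x ∈ π, 2 ≤ x) ∧ π.card = k)

lemma mem_S {N k : ℕ} {π : Multiset ℕ} :
    π ∈ S N k ↔ (∀ x ∈ π, 2 ≤ x) ∧ π.card = k ∧ π.sum ≤ N := by
  unfold S
  simp only [Finset.mem_filter, Finset.mem_biUnion, Finset.mem_range, Finset.mem_image,
    Finset.mem_univ, true_and]
  constructor
  · rintro ⟨⟨m, hm, p, rfl⟩, h1, h2⟩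
    refine ⟨h1, h2, ?_⟩
    rw [p.parts_sum]; omega
  · rintro ⟨h1, h2, h3⟩
    exact ⟨⟨π.sum, by omega, ⟨π, fun {i} hi => by have := h1 i hi; omega, rfl⟩, rfl⟩, h1, h2⟩

/-- the run of consecutive parts starting at `j` has odd length -/
def R (j : ℕ) (π : Multiset ℕ) : Prop :=
  ∃ t, Odd t ∧ (∀ i < t, j + i ∈ π) ∧ j + t ∉ π

lemma exists_run (j : ℕ) (π : Multiset ℕ) : ∃ t, (∀ i < t, j + i ∈ π) ∧ j + t ∉ π := by
  have h : ∃ t, j + t ∉ π := by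
    refine ⟨π.sum + 1, fun h => ?_⟩
    have := Multiset.single_le_sum (fun x _ => Nat.zero_le x) _ h
    omega
  exact ⟨Nat.find h, fun i hi => by_contra fun hc => Nat.find_min h hi hc, Nat.find_spec h⟩

lemma run_unique {j : ℕ} {π : Multiset ℕ} {t u : ℕ} (h1 : ∀ i < t, j + i ∈ π) (h2 : j + t ∉ π)
    (h3 : ∀ i < u, j + i ∈ π) (h4 : j + u ∉ π) : t = u := by
  rcases lt_trichotomy t u with h | h | h
  · exact absurd (h3 t h) h2
  · exact h
  · exact absurd (h1 u h) h4

lemma R_rec (j : ℕ) (π : Multiset ℕ) : R j π ↔ j ∈ π ∧ ¬ R (j+1) π := by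
  obtain ⟨u, hu1, hu2⟩ := exists_run (j+1) π
  have hR : R (j+1) π ↔ Odd u := by
    constructor
    · rintro ⟨t, ht, h1, h2⟩
      rwa [← run_unique h1 h2 hu1 hu2]
    · intro h; exact ⟨u, h, hu1, hu2⟩
  rw [hR]
  constructor
  · rintro ⟨t, ht, h1, h2⟩
    rcases t with _ | t
    · simp at ht
    · refine ⟨by simpa using h1 0 (by omega), ?_⟩
      have : t = u := run_unique (j := j+1)
        (fun i hi => by have := h1 (i+1) (by omega); rwa [show j+1+i = j+(i+1) by ring])
        (by rwa [show j+1+t = j+(t+1) by ring]) hu1 hu2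
      subst this
      intro h3
      rcases ht with ⟨a, ha⟩
      rcases h3 with ⟨b, hb⟩
      omega
  · rintro ⟨h1, h2⟩
    refine ⟨u+1, by rw [Nat.not_odd_iff_even] at h2; exact h2.add_one, ?_, ?_⟩
    · intro i hi
      rcases i with _ | i
      · simpa using h1
      · have := hu1 i (by omega)
        rwa [show j+(i+1) = j+1+i by ring]
    · rwa [show j+(u+1) = j+1+u by ring]

lemma R_cons (j : ℕ) (π : Multiset ℕ) : R (j+1) (j ::ₘ π) ↔ R (j+1) π := by
  have : ∀ i, j + 1 + i ∈ j ::ₘ π ↔ j + 1 + i ∈ π := by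
    intro i
    rw [Multiset.mem_cons]
    constructor
    · rintro (h | h)
      · omega
      · exact h
    · exact Or.inr
  unfold R
  simp only [this]

lemma mex_rec (j : ℕ) (hj : 2 ≤ j) (M k : ℕ) :
    ((S (M+j) (k+1)).filter (R j)).card + ((S M k).filter (R (j+1))).card = (S M k).card := by
  rw [← Finset.card_filter_add_card_filter_not (s := S M k) (R (j+1)), add_comm]
  congr 1
  apply Finset.card_nbij' (fun π => π.erase j) (fun π => j ::ₘ π)
  · intro π hπ
    simp only [Finset.mem_coe, Finset.mem_filter, mem_S] at hπ ⊢
    obtain ⟨⟨h1, h2, h3⟩, h4⟩ := hπ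
    rw [R_rec] at h4
    obtain ⟨ρ, rfl⟩ := Multiset.exists_cons_of_mem h4.1
    rw [R_cons] at h4
    simp at h1 h2 h3 ⊢
    exact ⟨⟨h1.2, h2, by omega⟩, h4.2⟩
  · intro π hπ
    simp only [Finset.mem_coe, Finset.mem_filter, mem_S] at hπ ⊢
    obtain ⟨⟨h1, h2, h3⟩, h4⟩ := hπ
    rw [R_rec, R_cons]
    simp
    exact ⟨⟨⟨hj, h1⟩, h2, by omega⟩, h4⟩
  · intro π hπ
    simp only [Finset.mem_coe, Finset.mem_filter, mem_S] at hπ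
    exact Multiset.cons_erase ((R_rec _ _).1 hπ.2).1
  · intro π hπ
    simp

/-- crank-type condition -/
def E (N j : ℕ) (π : Multiset ℕ) : Prop := N - π.sum < c π (N - π.sum + j)

lemma caseA (j : ℕ) (hj : 2 ≤ j) (M k : ℕ) :
    ((S (M+j) (k+1)).filter (fun ν => dur j ν < c ν (dur j ν + j))).card
      = ((S M k).filter (fun ρ => ¬ E M (j+1) ρ)).card := by
  apply Finset.card_nbij' (fun π => π.erase (dur j π + j)) (fun π => (dur j π + j) ::ₘ π)
  · intro π hπ
    simp only [Finset.mem_coe, Finset.mem_filter, mem_S] at hπ ⊢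
    obtain ⟨⟨h1, h2, h3⟩, h4⟩ := hπ
    have h5 := dur_spec j π
    have h6 := c_count π (dur j π + j)
    have h7 : dur j π + j ∈ π := Multiset.count_pos.1 (by omega)
    generalize dur j π = d at *
    obtain ⟨ρ, rfl⟩ := Multiset.exists_cons_of_mem h7
    rw [c_cons] at h4 h5
    simp at h1 h2 h3 h4 h5 ⊢
    have h8 : dur j ρ = d := dur_eq (by omega) h5
    refine ⟨⟨h1.2, h2, by omega⟩, ?_⟩
    unfold E
    rw [← add_assoc, lt_dur]
    omega
  · intro ρ hρ
    simp only [Finset.mem_coe, Finset.mem_filter, mem_S] at hρ ⊢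
    obtain ⟨⟨h1, h2, h3⟩, h4⟩ := hρ
    unfold E at h4
    rw [← add_assoc, lt_dur] at h4
    have h5 := dur_spec j ρ
    have h6 := dur_le j ρ
    generalize dur j ρ = d at *
    have h8 : dur j ((d+j) ::ₘ ρ) = d := by
      apply dur_eq <;> rw [c_cons] <;> simp <;> omega
    rw [h8, c_cons]
    simp
    exact ⟨⟨⟨by omega, h1⟩, h2, by omega⟩, by omega⟩
  · intro π hπ
    simp only [Finset.mem_coe, Finset.mem_filter, mem_S] at hπ
    obtain ⟨⟨h1, h2, h3⟩, h4⟩ := hπ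
    have h5 := dur_spec j π
    have h6 := c_count π (dur j π + j)
    have h7 : dur j π + j ∈ π := Multiset.count_pos.1 (by omega)
    beta_reduce
    generalize dur j π = d at *
    obtain ⟨ρ, rfl⟩ := Multiset.exists_cons_of_mem h7
    rw [c_cons] at h4 h5
    simp at h4 h5 ⊢
    exact dur_eq (by omega) h5
  · intro ρ hρ
    have h5 := dur_spec j ρ
    have h6 := dur_le j ρ
    simp only
    generalize dur j ρ = d at *
    have h8 : dur j ((d+j) ::ₘ ρ) = d := by
      apply dur_eq <;> rw [c_cons] <;> simp <;> omega
    rw [h8]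
    simp

/-- lower all parts that are at least `a` by one -/
def low (a : ℕ) (π : Multiset ℕ) : Multiset ℕ := π.map (fun x => if a ≤ x then x - 1 else x)

lemma low_sum (a : ℕ) (ha : 1 ≤ a) (π : Multiset ℕ) : (low a π).sum + c π a = π.sum := by
  induction π using Multiset.induction_on with
  | empty => simp [low, c]
  | cons b s ih =>
    rw [c_cons]
    simp only [low, Multiset.map_cons, Multiset.sum_cons] at ih ⊢
    split_ifs <;> omega

lemma c_low_le (a x : ℕ) (hx : x < a) (π : Multiset ℕ) : c (low a π) x = c π x := by
  induction π using Multiset.induction_on with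
  | empty => simp [low, c]
  | cons b s ih =>
    simp only [low, Multiset.map_cons, c_cons] at ih ⊢
    rw [ih]
    split_ifs <;> omega

lemma c_low_ge (a x : ℕ) (ha : 1 ≤ a) (hx : a ≤ x) (π : Multiset ℕ) : c (low a π) x = c π (x+1) := by
  induction π using Multiset.induction_on with
  | empty => simp [low, c]
  | cons b s ih =>
    simp only [low, Multiset.map_cons, c_cons] at ih ⊢
    rw [ih]
    split_ifs <;> omega

/-- the top `d` parts -/
lemma exists_top (d : ℕ) (π : Multiset ℕ) (a : ℕ) (h1 : d ≤ c π a) (h2 : c π (a+1) ≤ d) :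
    ∃ T U, π = T + U ∧ T.card = d ∧ (∀ x ∈ T, a ≤ x) ∧ (∀ x ∈ U, x ≤ a) := by
  have hc := c_count π a
  have e1 : π = π.filter (fun x => a + 1 ≤ x) + π.filter (fun x => ¬ a + 1 ≤ x) :=
    (Multiset.filter_add_not _ _).symm
  have e2 : Multiset.replicate (d - c π (a+1)) a ≤ π.filter (fun x => ¬ a + 1 ≤ x) := by
    rw [← Multiset.le_count_iff_replicate_le, Multiset.count_filter]
    simp; omega
  obtain ⟨U, hU⟩ := Multiset.le_iff_exists_add.1 e2
  refine ⟨π.filter (fun x => a + 1 ≤ x) + Multiset.replicate (d - c π (a+1)) a, U, ?_, ?_, ?_, ?_⟩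
  · rw [add_assoc, ← hU]; exact e1
  · rw [Multiset.card_add, ← Multiset.countP_eq_card_filter, Multiset.card_replicate]
    change c π (a+1) + _ = d
    omega
  · intro x hx
    rw [Multiset.mem_add, Multiset.mem_filter] at hx
    rcases hx with hx | hx
    · omega
    · rw [Multiset.eq_of_mem_replicate hx]
  · intro x hx
    have : x ∈ π.filter (fun x => ¬ a + 1 ≤ x) := by
      rw [hU]; exact Multiset.mem_add.2 (Or.inr hx)
    have := (Multiset.mem_filter.1 this).2
    omega

lemma low_top (a : ℕ) (T U : Multiset ℕ) (hT : ∀ x ∈ T, a ≤ x) (hU : ∀ x ∈ U, x ≤ a) :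
    low (a+1) (T.map (· + 1) + U) = T + U := by
  unfold low
  rw [Multiset.map_add, Multiset.map_map]
  congr 1
  · conv_rhs => rw [← Multiset.map_id T]
    apply Multiset.map_congr rfl
    intro x hx
    have := hT x hx
    simp [this]
  · conv_rhs => rw [← Multiset.map_id U]
    apply Multiset.map_congr rfl
    intro x hx
    have := hU x hx
    simp; omega

lemma dur_low (s : ℕ) (ν : Multiset ℕ)
    (h : ¬ dur (s+1) ν < c ν (dur (s+1) ν + (s+1))) :
    dur s (low (dur (s+1) ν + s + 1) ν) = dur (s+1) ν := by
  have h1 := dur_spec (s+1) ν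
  have h2 := dur_le (s+1) ν
  generalize dur (s+1) ν = d at *
  apply dur_eq
  · rw [c_low_le _ _ (by omega)]
    exact h2.trans (c_anti _ (by omega))
  · rw [c_low_ge _ _ (by omega) (by omega)]
    exact h1

lemma caseB (s : ℕ) (hs : 1 ≤ s) (N k : ℕ) :
    ((S N k).filter (fun ν => ¬ dur (s+1) ν < c ν (dur (s+1) ν + (s+1)))).card
      = ((S N k).filter (fun ρ => ¬ E N (s+1) ρ)).card := by
  apply Finset.card_bij (fun ν _ => low (dur (s+1) ν + s + 1) ν)
  · intro ν hν
    simp only [Finset.mem_filter, mem_S] at hν ⊢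
    obtain ⟨⟨h1, h2, h3⟩, h4⟩ := hν
    have h5 := dur_low s ν h4
    have h6 := dur_le (s+1) ν
    unfold E
    rw [← add_assoc, lt_dur, h5]
    generalize dur (s+1) ν = d at *
    have h7 := low_sum (d+s+1) (by omega) ν
    rw [← add_assoc] at h4 h6
    refine ⟨⟨?_, by simp [low, h2], by omega⟩, by omega⟩
    intro x hx
    obtain ⟨y, hy, rfl⟩ := Multiset.mem_map.1 hx
    have := h1 y hy
    beta_reduce
    split_ifs with hyd
    · have : 0 < c ν (d+s+1) := Multiset.countP_pos.2 ⟨y, hy, hyd⟩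
      omega
    · omega
  · intro ν hν ν' hν' h
    simp only [Finset.mem_filter] at hν hν'
    have h5 := dur_low s ν hν.2
    have h5' := dur_low s ν' hν'.2
    have hd : dur (s+1) ν = dur (s+1) ν' := by rw [← h5, ← h5', h]
    have h6 := dur_le (s+1) ν
    have h6' := dur_le (s+1) ν'
    have h7 := hν.2
    have h7' := hν'.2
    rw [← hd] at h h6' h7'
    generalize dur (s+1) ν = d at *
    apply ext_c
    intro x
    rcases lt_trichotomy x (d+s+1) with hx | hx | hx
    · rw [← c_low_le _ _ hx, h, c_low_le _ _ hx]
    · subst hx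
      rw [← add_assoc] at *
      omega
    · obtain ⟨y, rfl⟩ : ∃ y, x = y + 1 := ⟨x-1, by omega⟩
      rw [← c_low_ge (d+s+1) y (by omega) (by omega), h, c_low_ge (d+s+1) y (by omega) (by omega)]
  · intro ρ hρ
    simp only [Finset.mem_filter, mem_S] at hρ
    obtain ⟨⟨h1, h2, h3⟩, h4⟩ := hρ
    unfold E at h4
    rw [← add_assoc, lt_dur] at h4
    have h5 := dur_spec s ρ
    have h6 := dur_le s ρ
    generalize dur s ρ = d at *
    obtain ⟨T, U, rfl, hT, hT', hU⟩ := exists_top d ρ (d+s) h6 h5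
    have hl := low_top (d+s) T U hT' hU
    have hcU : ∀ x, d + s < x → c U x = 0 := by
      intro x hx
      unfold c
      rw [Multiset.countP_eq_zero]
      intro y hy
      have := hU y hy
      omega
    have hcadd : ∀ x, c (T.map (· + 1) + U) x = c (T.map (· + 1)) x + c U x := by
      intro x; exact Multiset.countP_add _ _ _
    have hcT : c (T.map (· + 1)) (d+s+1) = d := by
      unfold c
      rw [← hT, ← Multiset.card_map (· + 1) T, Multiset.countP_eq_card]
      intro y hy
      obtain ⟨z, hz, rfl⟩ := Multiset.mem_map.1 hy
      have := hT' z hz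
      simp only [Multiset.card_map]
      omega
    have e1 : c (T.map (· + 1) + U) (d+s+1) = d := by rw [hcadd, hcT, hcU _ (by omega)]; rfl
    have e2 : dur (s+1) (T.map (· + 1) + U) = d := by
      apply dur_eq
      · rw [← add_assoc, e1]
      · have := c_anti (T.map (· + 1) + U) (show d+s+1 ≤ d+(s+1)+1 by omega)
        omega
    refine ⟨T.map (· + 1) + U, ?_, ?_⟩
    · simp only [Finset.mem_filter, mem_S]
      rw [e2, ← add_assoc, e1]
      have hsum := low_sum (d+s+1) (by omega) (T.map (· + 1) + U)
      rw [hl, e1] at hsum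
      refine ⟨⟨?_, ?_, by omega⟩, by omega⟩
      · intro x hx
        rcases Multiset.mem_add.1 hx with hx | hx
        · obtain ⟨z, hz, rfl⟩ := Multiset.mem_map.1 hx
          have := hT' z hz
          omega
        · exact h1 x (Multiset.mem_add.2 (Or.inr hx))
      · rw [← h2]; simp
    · rw [e2, hl]

lemma crank_rec (j : ℕ) (hj : 2 ≤ j) (M k : ℕ) :
    ((S (M+j) (k+1)).filter (E (M+j) j)).card + ((S M k).filter (E M (j+1))).card
      = (S M k).card := by
  have hA := caseA j hj M k
  obtain ⟨s, rfl⟩ : ∃ s, j = s + 1 := ⟨j-1, by omega⟩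
  have hB := caseB s (by omega) (M+(s+1)) (k+1)
  have h1 := Finset.card_filter_add_card_filter_not (s := S (M+(s+1)) (k+1))
    (fun ν => dur (s+1) ν < c ν (dur (s+1) ν + (s+1)))
  have h2 := Finset.card_filter_add_card_filter_not (s := S (M+(s+1)) (k+1)) (E (M+(s+1)) (s+1))
  have h3 := Finset.card_filter_add_card_filter_not (s := S M k) (E M (s+1+1))
  omega

lemma E_mem {N j : ℕ} {π : Multiset ℕ} (h : E N j π) : ∃ x ∈ π, j ≤ x := by
  unfold E c at h
  obtain ⟨x, hx, hx'⟩ := Multiset.countP_pos.1 (lt_of_le_of_lt (Nat.zero_le _) h)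
  exact ⟨x, hx, by omega⟩

lemma key (k : ℕ) : ∀ (j : ℕ), 2 ≤ j → ∀ N : ℕ,
    ((S N k).filter (E N j)).card = ((S N k).filter (R j)).card := by
  induction k with
  | zero =>
    intro j hj N
    rw [Finset.filter_false_of_mem, Finset.filter_false_of_mem]
    · intro π hπ h
      have := ((R_rec _ _).1 h).1
      rw [mem_S, Multiset.card_eq_zero] at hπ
      rw [hπ.2.1] at this
      simp at this
    · intro π hπ h
      obtain ⟨x, hx, -⟩ := E_mem h
      rw [mem_S, Multiset.card_eq_zero] at hπ
      rw [hπ.2.1] at hx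
      simp at hx
  | succ k ih =>
    intro j hj N
    by_cases hN : j ≤ N
    · obtain ⟨M, rfl⟩ : ∃ M, N = M + j := ⟨N - j, by omega⟩
      have h1 := crank_rec j hj M k
      have h2 := mex_rec j hj M k
      have h3 := ih (j+1) (by omega) M
      omega
    · rw [Finset.filter_false_of_mem, Finset.filter_false_of_mem]
      · intro π hπ h
        have h1 := ((R_rec _ _).1 h).1
        rw [mem_S] at hπ
        have := Multiset.single_le_sum (fun x _ => Nat.zero_le x) _ h1
        omega
      · intro π hπ h
        obtain ⟨x, h1, h2⟩ := E_mem h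
        rw [mem_S] at hπ
        have := Multiset.single_le_sum (fun x _ => Nat.zero_le x) _ h1
        omega

lemma split_ones {n : ℕ} (p : n.Partition) :
    p.parts = p.parts.filter (fun x => 1 < x) + Multiset.replicate (p.parts.count 1) 1 := by
  conv_lhs => rw [← Multiset.filter_add_not (fun x => 1 < x) p.parts]
  congr 1
  rw [← Multiset.filter_eq']
  apply Multiset.filter_congr
  intro x hx
  have := p.parts_pos hx
  omega

lemma transfer (n k : ℕ) (P : n.Partition → Prop) (Q : Multiset ℕ → Prop)
    (h : ∀ p : n.Partition, P p ↔ Q (p.parts.filter (fun x => 1 < x))) :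
    {p : n.Partition | P p ∧ betaStat p = k}.ncard = ((S n k).filter Q).card := by
  rw [← Set.ncard_coe_finset]
  apply Set.ncard_congr (fun p _ => p.parts.filter (fun x => 1 < x))
  · rintro p ⟨h1, h2⟩
    simp only [Finset.mem_coe, Finset.mem_filter, mem_S]
    refine ⟨⟨fun x hx => (Multiset.mem_filter.1 hx).2, h2, ?_⟩, (h p).1 h1⟩
    have := congrArg Multiset.sum (split_ones p)
    rw [p.parts_sum, Multiset.sum_add] at this
    omega
  · intro p q _ _ hpq
    have h1 := split_ones p
    have h2 := split_ones q
    have h3 := congrArg Multiset.sum h1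
    have h4 := congrArg Multiset.sum h2
    rw [p.parts_sum, Multiset.sum_add] at h3
    rw [q.parts_sum, Multiset.sum_add] at h4
    beta_reduce at hpq
    rw [hpq] at h1 h3
    simp only [Multiset.sum_replicate, smul_eq_mul, mul_one] at h3 h4
    have h5 : p.parts.count 1 = q.parts.count 1 := by omega
    rw [h5] at h1
    exact Nat.Partition.ext (h1.trans h2.symm)
  · intro π hπ
    simp only [Finset.mem_coe, Finset.mem_filter, mem_S] at hπ
    obtain ⟨⟨h1, h2, h3⟩, h4⟩ := hπ
    have hf : (π + Multiset.replicate (n - π.sum) 1).filter (fun x => 1 < x) = π := by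
      rw [Multiset.filter_add, (Multiset.filter_eq_self (p := fun x => 1 < x)).2 h1, Multiset.filter_eq_nil.2]
      · simp
      · intro a ha
        rw [Multiset.eq_of_mem_replicate ha]; omega
    let p : n.Partition := ⟨π + Multiset.replicate (n - π.sum) 1, by
      intro i hi
      rcases Multiset.mem_add.1 hi with hi | hi
      · have := h1 i hi; omega
      · rw [Multiset.eq_of_mem_replicate hi]; omega, by
      rw [Multiset.sum_add, Multiset.sum_replicate, smul_eq_mul]; omega⟩
    refine ⟨p, ⟨(h p).2 ?_, ?_⟩, hf⟩
    · change Q ((π + Multiset.replicate (n - π.sum) 1).filter (fun x => 1 < x))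
      rwa [hf]
    · change ((π + Multiset.replicate (n - π.sum) 1).filter (fun x => 1 < x)).card = k
      rwa [hf]

lemma count_one {n : ℕ} (p : n.Partition) :
    (p.parts.filter (fun x => 1 < x)).sum + p.parts.count 1 = n := by
  have := congrArg Multiset.sum (split_ones p)
  rw [p.parts_sum, Multiset.sum_add] at this
  simp only [Multiset.sum_replicate, smul_eq_mul, mul_one] at this
  omega

lemma odd_mex {n : ℕ} (p : n.Partition) : Odd (mex p) ↔ ¬ R 1 p.parts := by
  obtain ⟨t, h1, h2⟩ := exists_run 1 p.parts
  have hm : mex p = 1 + t := by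
    unfold mex
    apply le_antisymm
    · exact Nat.sInf_le (show 1 + t ∈ {m : ℕ | 0 < m ∧ m ∉ p.parts} from ⟨by omega, h2⟩)
    · apply le_csInf (Set.nonempty_of_mem (show 1 + t ∈ {m : ℕ | 0 < m ∧ m ∉ p.parts} from ⟨by omega, h2⟩))
      rintro m ⟨hm, hm'⟩
      by_contra hc
      have := h1 (m-1) (by omega)
      rw [show 1 + (m-1) = m by omega] at this
      exact hm' this
  have hR : R 1 p.parts ↔ Odd t := by
    constructor
    · rintro ⟨u, hu, h3, h4⟩
      rwa [← run_unique h3 h4 h1 h2]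
    · intro h; exact ⟨t, h, h1, h2⟩
  rw [hm, hR, Nat.odd_add, Nat.not_odd_iff_even]
  simp

lemma R_filter (π : Multiset ℕ) : R 2 (π.filter (fun x => 1 < x)) ↔ R 2 π := by
  have : ∀ i, 2 + i ∈ π.filter (fun x => 1 < x) ↔ 2 + i ∈ π := by
    intro i
    rw [Multiset.mem_filter]
    constructor
    · exact fun h => h.1
    · exact fun h => ⟨h, by omega⟩
  unfold R
  simp only [this]

lemma mex_iff {n : ℕ} (p : n.Partition) : Odd (mex p) ↔
    (fun π : Multiset ℕ => n ≤ π.sum ∨ (π.sum < n ∧ R 2 π)) (p.parts.filter (fun x => 1 < x)) := by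
  have h := count_one p
  have h1 : 1 ∈ p.parts ↔ 0 < p.parts.count 1 := Multiset.count_pos.symm
  rw [odd_mex, R_rec, h1]
  simp only [R_filter]
  have h3 : n ≤ (p.parts.filter (fun x => 1 < x)).sum ↔ ¬ 0 < p.parts.count 1 := by omega
  have h4 : (p.parts.filter (fun x => 1 < x)).sum < n ↔ 0 < p.parts.count 1 := by omega
  change ¬ (_ ∧ ¬ R 2 p.parts) ↔ _
  rw [h3, h4]
  tauto

lemma crank_iff {n : ℕ} (p : n.Partition) : 0 ≤ crank p ↔
    (fun π : Multiset ℕ => n ≤ π.sum ∨ (π.sum < n ∧ E (n-1) 2 π))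
      (p.parts.filter (fun x => 1 < x)) := by
  have h := count_one p
  unfold crank muStat omegaStat
  split_ifs with h0
  · have : n ≤ (p.parts.filter (fun x => 1 < x)).sum := by omega
    simp [this]
  · have hw : n - 1 - (p.parts.filter (fun x => 1 < x)).sum + 2 = p.parts.count 1 + 1 := by omega
    have hE : E (n-1) 2 (p.parts.filter (fun x => 1 < x)) ↔
        p.parts.count 1 ≤ (p.parts.filter (fun x => p.parts.count 1 < x)).card := by
      unfold E c
      rw [hw, Multiset.countP_filter, Multiset.countP_eq_card_filter]
      have : p.parts.filter (fun x => p.parts.count 1 + 1 ≤ x ∧ 1 < x) =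
          p.parts.filter (fun x => p.parts.count 1 < x) := by
        apply Multiset.filter_congr
        intro x hx
        omega
      rw [this]
      omega
    simp only [hE]
    omega

lemma split_card (n k : ℕ) (hn : 0 < n) (Q : Multiset ℕ → Prop) :
    ((S n k).filter (fun π => n ≤ π.sum ∨ (π.sum < n ∧ Q π))).card =
      ((S n k).filter (fun π => n ≤ π.sum)).card + ((S (n-1) k).filter Q).card := by
  rw [Finset.filter_or, Finset.card_union_of_disjoint]
  · congr 2
    ext π
    simp only [Finset.mem_filter, mem_S]
    constructor
    · rintro ⟨⟨h1, h2, h3⟩, h4, h5⟩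
      exact ⟨⟨h1, h2, by omega⟩, h5⟩
    · rintro ⟨⟨h1, h2, h3⟩, h5⟩
      exact ⟨⟨h1, h2, by omega⟩, by omega, h5⟩
  · rw [Finset.disjoint_filter]
    intro π _ h1 h2
    omega

end CrankMex

theorem crank_mex_refined (n k : ℕ) (hn : 0 < n) :
    {p : Nat.Partition n | Odd (mex p) ∧ betaStat p = k}.ncard = {p : Nat.Partition n | 0 ≤ crank p ∧ betaStat p = k}.ncard := by
  rw [CrankMex.transfer n k _ (fun π => n ≤ π.sum ∨ (π.sum < n ∧ CrankMex.R 2 π)) (CrankMex.mex_iff (n := n)), CrankMex.transfer n k _ (fun π => n ≤ π.sum ∨ (π.sum < n ∧ CrankMex.E (n-1) 2 π)) (CrankMex.crank_iff (n := n))]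
  have h1 := CrankMex.split_card n k hn (CrankMex.R 2)
  have h2 := CrankMex.split_card n k hn (CrankMex.E (n-1) 2)
  rw [CrankMex.key k 2 le_rfl, ← h1] at h2
  convert h2.symm
end
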